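/- For every real t > 0, -i·t·( β(t/2) + ∫_0^∞ (1/s - 1/(1 - e^{-s}))·e^{-ts/2} ds ) = ∫_ℝ (1 + itx)/(it - x) · (1/2)·|x|·e^{-π|x|/4} / ((1 + x²)·cosh(π|x|/4)) dx, where β(z) := ∫_0^∞ e^{-zs}/(1 + e^{-s}) ds for z > 0 and the integrals are complex-valued. -/

import Mathlib

/-- The beta function via its Laplace-integral representation,
`β(z) = ∫_0^∞ e^{-zs}/(1 + e^{-s}) ds` for `z > 0`. -/
noncomputable def betaFn (z : ℝ) : ℝ :=
  ∫ s in Set.Ioi (0 : ℝ), Real.exp (-z * s) / (1 + Real.exp (-s))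

open MeasureTheory Set

/-- Partial fraction expansion of the hyperbolic cotangent. -/
lemma hasSum_coth_sub_inv {s : ℝ} (hs : 0 < s) :
    HasSum (fun n : ℕ ↦ 2 * s / (s ^ 2 + (Real.pi * (n + 1)) ^ 2))
      (Real.cosh s / Real.sinh s - 1 / s) := by
  have hpi : (Real.pi : ℂ) ≠ 0 := by exact_mod_cast Real.pi_ne_zero
  have hs0 : (s : ℂ) ≠ 0 := by exact_mod_cast hs.ne'
  have hsh : Complex.sinh s ≠ 0 := by
    rw [← Complex.ofReal_sinh]
    exact_mod_cast (Real.sinh_pos_iff.2 hs).ne'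
  have hx : (s / Real.pi : ℝ) * Complex.I ∈ Complex.integerComplement := by
    rintro ⟨n, hn⟩
    have := congrArg Complex.im hn
    rw [Complex.intCast_im, Complex.im_ofReal_mul, Complex.I_im, mul_one] at this
    exact (div_pos hs Real.pi_pos).ne this
  have hsum := (summable_cotTerm hx).hasSum
  rw [← cot_series_rep' hx] at hsum
  have h := hsum.mul_left (Complex.I / Real.pi)
  rw [← Complex.hasSum_ofReal]
  have hterm (n : ℕ) : ((2 * s / (s ^ 2 + (Real.pi * (n + 1)) ^ 2) : ℝ) : ℂ) =
      Complex.I / Real.pi * cotTerm ((s / Real.pi : ℝ) * Complex.I) n := by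
    have h1 : (s : ℂ) ^ 2 + Real.pi ^ 2 * (n + 1) ^ 2 ≠ 0 := by
      exact_mod_cast (by positivity : s ^ 2 + Real.pi ^ 2 * ((n : ℝ) + 1) ^ 2 ≠ 0)
    rw [cotTerm_identity hx n]
    push_cast
    have h2 : ((s : ℂ) / Real.pi * Complex.I + (n + 1)) * (s / Real.pi * Complex.I - (n + 1)) =
        -(s ^ 2 + Real.pi ^ 2 * (n + 1) ^ 2) / Real.pi ^ 2 := by
      field_simp
      linear_combination (s : ℂ) ^ 2 * Complex.I_sq
    rw [h2, mul_pow]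
    field_simp
    simp
  have hlim : ((Real.cosh s / Real.sinh s - 1 / s : ℝ) : ℂ) = Complex.I / Real.pi *
      (Real.pi * Complex.cot (Real.pi * ((s / Real.pi : ℝ) * Complex.I)) -
        1 / ((s / Real.pi : ℝ) * Complex.I)) := by
    have hm : (Real.pi : ℂ) * ((s / Real.pi : ℝ) * Complex.I) = s * Complex.I := by
      push_cast
      field_simp
    rw [hm, Complex.cot, Complex.cos_mul_I, Complex.sin_mul_I]
    push_cast
    field_simp
  rw [hlim]
  exact h.congr_fun hterm

lemma integrableOn_exp_neg_mul_sin {a : ℝ} (ha : 0 < a) (b : ℝ) :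
    IntegrableOn (fun x : ℝ ↦ Real.exp (-a * x) * Real.sin (b * x)) (Ioi 0) := by
  refine (integrableOn_exp_mul_Ioi (neg_lt_zero.2 ha) 0).mono' (by fun_prop) (.of_forall fun x ↦ ?_)
  rw [norm_mul, Real.norm_of_nonneg (Real.exp_nonneg _)]
  exact mul_le_of_le_one_right (Real.exp_nonneg _) (Real.abs_sin_le_one _)

/-- The Laplace transform of the sine. -/
lemma integral_exp_neg_mul_sin {a : ℝ} (ha : 0 < a) (b : ℝ) :
    ∫ x in Ioi (0 : ℝ), Real.exp (-a * x) * Real.sin (b * x) = b / (a ^ 2 + b ^ 2) := by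
  have hre : (-a + b * Complex.I : ℂ).re < 0 := by simpa
  have h := integral_exp_mul_complex_Ioi hre 0
  have h2 := congrArg Complex.im h
  rw [← RCLike.im_to_complex, ← integral_im (integrableOn_exp_mul_complex_Ioi hre 0)] at h2
  convert h2 using 1
  · refine integral_congr_ae (.of_forall fun x ↦ ?_)
    simp [Complex.exp_im]
  · simp [Complex.div_im, Complex.normSq]
    ring

lemma mul_exp_half_le_exp_sub_one {y : ℝ} (hy : 0 ≤ y) :
    y * Real.exp (y / 2) ≤ Real.exp y - 1 := by
  have h := Real.self_le_sinh_iff.2 (by positivity : 0 ≤ y / 2)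
  rw [Real.sinh_eq] at h
  have e : Real.exp y = Real.exp (y / 2) * Real.exp (y / 2) := by
    rw [← Real.exp_add]; ring_nf
  have e2 : Real.exp (-(y / 2)) * Real.exp (y / 2) = 1 := by
    rw [← Real.exp_add]; simp
  nlinarith [Real.exp_pos (y / 2)]

lemma integrableOn_sin_div_exp_sub_one {s c : ℝ} (hc : 0 < c) :
    IntegrableOn (fun x : ℝ ↦ Real.sin (s * x) / (Real.exp (c * x) - 1)) (Ioi 0) := by
  have hc2 : -(c / 2) < 0 := by linarith
  refine ((integrableOn_exp_mul_Ioi hc2 0).const_mul (|s| / c)).mono'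
    (Measurable.aestronglyMeasurable (by fun_prop)) ((ae_restrict_iff' measurableSet_Ioi).2 (.of_forall fun x hx ↦ ?_))
  have hx0 : 0 < x := hx
  have hcx : 0 < c * x := mul_pos hc hx0
  have h1 := mul_exp_half_le_exp_sub_one hcx.le
  have h2 : 0 < Real.exp (c * x) - 1 := by
    have := Real.add_one_lt_exp hcx.ne'
    linarith
  have h3 : |Real.sin (s * x)| ≤ |s| * x := by
    simpa [abs_mul, abs_of_pos hx0] using Real.abs_sin_le_abs (x := s * x)
  rw [norm_div, Real.norm_eq_abs, Real.norm_of_nonneg h2.le, div_le_iff₀ h2]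
  have e : Real.exp (-(x * c / 2)) * Real.exp (x * c / 2) = 1 := by
    rw [← Real.exp_add]; simp
  calc |Real.sin (s * x)| ≤ |s| * x := h3
    _ = |s| / c * Real.exp (-(c / 2) * x) * (c * x * Real.exp (c * x / 2)) := by
      rw [show -(c / 2) * x = -(x * c / 2) by ring, show c * x / 2 = x * c / 2 by ring]
      field_simp
      rw [mul_assoc, e, mul_one]
    _ ≤ _ := by gcongr

/-- Legendre's formula: the sine transform of the Bose-Einstein kernel. -/
lemma integral_sin_div_exp_pi_sub_one {s : ℝ} (hs : 0 < s) :
    ∫ x in Ioi (0 : ℝ), Real.sin (s * x) / (Real.exp (Real.pi * x) - 1) =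
      (Real.cosh s / Real.sinh s - 1 / s) / 2 := by
  set F : ℕ → ℝ → ℝ := fun n x ↦ Real.exp (-(Real.pi * (n + 1)) * x) * Real.sin (s * x)
  have hpos (n : ℕ) : 0 < Real.pi * ((n : ℝ) + 1) := by positivity
  have hint (n : ℕ) : IntegrableOn (F n) (Ioi 0) := integrableOn_exp_neg_mul_sin (hpos n) s
  have hbound (n : ℕ) : ∫ x in Ioi (0 : ℝ), ‖F n x‖ ≤ s / Real.pi ^ 2 * (1 / ((n : ℝ) + 1) ^ 2) := by
    have hΓ := Real.integral_rpow_mul_exp_neg_mul_Ioi (a := 2) two_pos (hpos n)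
    rw [Real.Gamma_two, mul_one] at hΓ
    have hi : IntegrableOn (fun x : ℝ ↦ x ^ ((2 : ℝ) - 1) *
        Real.exp (-(Real.pi * ((n : ℝ) + 1) * x))) (Ioi 0) := by
      refine Integrable.of_integral_ne_zero ?_
      rw [hΓ]
      have := hpos n
      positivity
    calc ∫ x in Ioi (0 : ℝ), ‖F n x‖
      _ ≤ ∫ x in Ioi (0 : ℝ), s * (x ^ ((2 : ℝ) - 1) *
          Real.exp (-(Real.pi * ((n : ℝ) + 1) * x))) := by
        refine setIntegral_mono_on (hint n).norm (hi.const_mul s) measurableSet_Ioi fun x hx ↦ ?_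
        have hx0 : 0 < x := hx
        have h3 : |Real.sin (s * x)| ≤ s * x := by
          simpa [abs_mul, abs_of_pos hx0, abs_of_pos hs] using Real.abs_sin_le_abs (x := s * x)
        have h4 : (x : ℝ) ^ ((2 : ℝ) - 1) = x := by norm_num
        simp only [F]
        rw [norm_mul, Real.norm_of_nonneg (Real.exp_nonneg _), Real.norm_eq_abs, h4, neg_mul,
          ← mul_assoc, mul_comm (Real.exp _)]
        gcongr
      _ = s / Real.pi ^ 2 * (1 / ((n : ℝ) + 1) ^ 2) := by
        rw [integral_const_mul, hΓ, Real.rpow_two]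
        field_simp
  have hsummable : Summable fun n ↦ ∫ x in Ioi (0 : ℝ), ‖F n x‖ := by
    refine Summable.of_nonneg_of_le (fun n ↦ integral_nonneg fun x ↦ norm_nonneg _) hbound ?_
    refine Summable.mul_left _ ?_
    exact_mod_cast (summable_nat_add_iff 1).2 (Real.summable_one_div_nat_pow.2 one_lt_two)
  have h := hasSum_integral_of_summable_integral_norm hint hsummable
  have hF : ∫ x in Ioi (0 : ℝ), ∑' n, F n x =
      ∫ x in Ioi (0 : ℝ), Real.sin (s * x) / (Real.exp (Real.pi * x) - 1) := by
    refine setIntegral_congr_fun measurableSet_Ioi fun x hx ↦ ?_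
    have hq : Real.exp (-(Real.pi * x)) < 1 :=
      Real.exp_lt_one_iff.mpr (neg_lt_zero.2 (mul_pos Real.pi_pos hx))
    have hg := ((hasSum_geometric_of_lt_one (Real.exp_nonneg _) hq).mul_left
      (Real.exp (-(Real.pi * x)))).mul_right (Real.sin (s * x))
    have hFx : (fun n ↦ F n x) = fun n : ℕ ↦
        Real.exp (-(Real.pi * x)) * Real.exp (-(Real.pi * x)) ^ n * Real.sin (s * x) := by
      funext n
      simp only [F]
      rw [← Real.exp_nat_mul, ← Real.exp_add]
      ring_nf
    rw [hFx, hg.tsum_eq, Real.exp_neg]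
    have : Real.exp (Real.pi * x) - 1 ≠ 0 := by
      have := Real.add_one_lt_exp (mul_pos Real.pi_pos hx).ne'
      have := mul_pos Real.pi_pos hx
      linarith
    field_simp
  rw [hF] at h
  refine h.unique ?_
  refine ((hasSum_coth_sub_inv hs).div_const 2).congr_fun fun n ↦ ?_
  rw [integral_exp_neg_mul_sin (hpos n)]
  field_simp
  ring

/-- The sine transform of the Fermi-Dirac kernel. -/
lemma integral_sin_div_exp_pi_add_one {s : ℝ} (hs : 0 < s) :
    ∫ x in Ioi (0 : ℝ), Real.sin (x * s / 2) / (Real.exp (Real.pi * x / 2) + 1) =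
      1 / s - 1 / Real.sinh s := by
  have h1 := integrableOn_sin_div_exp_sub_one (s := s / 2) (half_pos Real.pi_pos)
  have h2 := (integrableOn_sin_div_exp_sub_one (s := s / 2) Real.pi_pos).const_mul 2
  have e : ∫ x in Ioi (0 : ℝ), Real.sin (x * s / 2) / (Real.exp (Real.pi * x / 2) + 1) =
      ∫ x in Ioi (0 : ℝ), (Real.sin (s / 2 * x) / (Real.exp (Real.pi / 2 * x) - 1) -
        2 * (Real.sin (s / 2 * x) / (Real.exp (Real.pi * x) - 1))) := by
    refine setIntegral_congr_fun measurableSet_Ioi fun x hx ↦ ?_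
    have hx0 : 0 < Real.pi / 2 * x := mul_pos (half_pos Real.pi_pos) hx
    have h3 : Real.exp (Real.pi * x) = Real.exp (Real.pi / 2 * x) ^ 2 := by
      rw [← Real.exp_nat_mul]; ring_nf
    have h4 : 1 < Real.exp (Real.pi / 2 * x) := Real.one_lt_exp_iff.2 hx0
    have h5 : Real.exp (Real.pi / 2 * x) - 1 ≠ 0 := by linarith
    have h7 : Real.exp (Real.pi / 2 * x) + 1 ≠ 0 := by linarith
    have h6 : Real.exp (Real.pi / 2 * x) ^ 2 - 1 =
        (Real.exp (Real.pi / 2 * x) - 1) * (Real.exp (Real.pi / 2 * x) + 1) := by ring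
    rw [h3, h6, show x * s / 2 = s / 2 * x by ring, show Real.pi * x / 2 = Real.pi / 2 * x by ring]
    generalize Real.exp (Real.pi / 2 * x) = E at *
    field_simp
    ring
  have e1 : ∫ x in Ioi (0 : ℝ), Real.sin (s / 2 * x) / (Real.exp (Real.pi / 2 * x) - 1) =
      2 * ((Real.cosh s / Real.sinh s - 1 / s) / 2) := by
    have := integral_comp_mul_left_Ioi
      (fun x ↦ Real.sin (s * x) / (Real.exp (Real.pi * x) - 1)) 0 (half_pos (zero_lt_one (α := ℝ)))
    rw [mul_zero, integral_sin_div_exp_pi_sub_one hs] at this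
    convert this using 1
    · refine integral_congr_ae (.of_forall fun x ↦ ?_)
      ring_nf
    · simp
  rw [e, integral_sub h1 h2, e1, integral_const_mul,
    integral_sin_div_exp_pi_sub_one (half_pos hs)]
  have hsh : 0 < Real.sinh (s / 2) := Real.sinh_pos_iff.2 (half_pos hs)
  have hch : 0 < Real.cosh (s / 2) := Real.cosh_pos _
  have a1 : Real.sinh s = 2 * Real.sinh (s / 2) * Real.cosh (s / 2) := by
    rw [← Real.sinh_two_mul]; ring_nf
  have a2 : Real.cosh s = 2 * Real.cosh (s / 2) ^ 2 - 1 := by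
    have := Real.cosh_two_mul (s / 2)
    have h := Real.cosh_sq (s / 2)
    rw [show 2 * (s / 2) = s by ring] at this
    linarith
  rw [a1, a2]
  field_simp
  ring

/-- The Laplace transform of `1 / s - 1 / sinh s`. -/
lemma integral_exp_mul_inv_sub_inv_sinh {t : ℝ} (ht : 0 < t) :
    ∫ s in Ioi (0 : ℝ), Real.exp (-(t / 2) * s) * (1 / s - 1 / Real.sinh s) =
      ∫ x in Ioi (0 : ℝ), 2 * x / ((t ^ 2 + x ^ 2) * (Real.exp (Real.pi * x / 2) + 1)) := by
  have ht2 : -(t / 2) < 0 := by linarith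
  have hpi2 : -(Real.pi / 2) < 0 := by linarith [Real.pi_pos]
  let f : ℝ → ℝ → ℝ := fun s x ↦
    Real.exp (-(t / 2) * s) * (Real.sin (x * s / 2) / (Real.exp (Real.pi * x / 2) + 1))
  have hf : Integrable (Function.uncurry f)
      ((volume.restrict (Ioi 0)).prod (volume.restrict (Ioi 0))) := by
    refine ((integrableOn_exp_mul_Ioi ht2 0).mul_prod (integrableOn_exp_mul_Ioi hpi2 0)).mono'
      (Measurable.aestronglyMeasurable (by unfold f; fun_prop)) (.of_forall fun ⟨s, x⟩ ↦ ?_)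
    simp only [Function.uncurry, f]
    rw [norm_mul, norm_div, Real.norm_of_nonneg (Real.exp_nonneg _), Real.norm_eq_abs,
      Real.norm_of_nonneg (by positivity), neg_mul (Real.pi / 2), Real.exp_neg, ← one_div,
      show Real.pi / 2 * x = Real.pi * x / 2 by ring]
    gcongr
    · exact Real.abs_sin_le_one _
    · linarith
  calc ∫ s in Ioi (0 : ℝ), Real.exp (-(t / 2) * s) * (1 / s - 1 / Real.sinh s)
    _ = ∫ s in Ioi (0 : ℝ), ∫ x in Ioi (0 : ℝ), f s x := by
      refine setIntegral_congr_fun measurableSet_Ioi fun s hs ↦ ?_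
      simp only [f]
      rw [integral_const_mul, integral_sin_div_exp_pi_add_one hs]
    _ = ∫ x in Ioi (0 : ℝ), ∫ s in Ioi (0 : ℝ), f s x := integral_integral_swap hf
    _ = _ := by
      refine setIntegral_congr_fun measurableSet_Ioi fun x _ ↦ ?_
      have hx : ∀ s, f s x = Real.exp (-(t / 2) * s) * Real.sin (x / 2 * s) /
          (Real.exp (Real.pi * x / 2) + 1) := fun s ↦ by
        simp only [f]
        rw [show x * s / 2 = x / 2 * s by ring, ← mul_div_assoc]
      simp only [hx]
      rw [integral_div, integral_exp_neg_mul_sin (half_pos ht)]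
      have : 0 < t ^ 2 + x ^ 2 := by positivity
      field_simp

lemma betaFn_add_integral {t : ℝ} (ht : 0 < t) :
    betaFn (t / 2) +
        ∫ s in Ioi (0 : ℝ), (1 / s - 1 / (1 - Real.exp (-s))) * Real.exp (-t * s / 2) =
      ∫ s in Ioi (0 : ℝ), Real.exp (-(t / 2) * s) * (1 / s - 1 / Real.sinh s) := by
  have ht2 : -(t / 2) < 0 := by linarith
  have h1 : IntegrableOn (fun s ↦ Real.exp (-(t / 2) * s) / (1 + Real.exp (-s))) (Ioi 0) := by
    refine (integrableOn_exp_mul_Ioi ht2 0).mono' (Measurable.aestronglyMeasurable (by fun_prop))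
      (.of_forall fun s ↦ ?_)
    rw [Real.norm_of_nonneg (by positivity)]
    exact div_le_self (Real.exp_nonneg _) (by linarith [Real.exp_pos (-s)])
  have h2 : IntegrableOn
      (fun s ↦ (1 / s - 1 / (1 - Real.exp (-s))) * Real.exp (-t * s / 2)) (Ioi 0) := by
    refine (integrableOn_exp_mul_Ioi ht2 0).mono' (Measurable.aestronglyMeasurable (by fun_prop))
      ((ae_restrict_iff' measurableSet_Ioi).2 (.of_forall fun s hs ↦ ?_))
    have hs0 : 0 < s := hs
    have ha : 1 - Real.exp (-s) ≤ s := by linarith [Real.add_one_le_exp (-s)]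
    have hb : 0 < 1 - Real.exp (-s) := sub_pos.2 (Real.exp_lt_one_iff.2 (neg_lt_zero.2 hs0))
    have hc : Real.exp (-s) * (s + 1) ≤ 1 := by
      rw [Real.exp_neg, inv_mul_le_one₀ (Real.exp_pos s)]
      exact Real.add_one_le_exp s
    have hd : 1 / s ≤ 1 / (1 - Real.exp (-s)) := one_div_le_one_div_of_le hb ha
    have he : 1 / (1 - Real.exp (-s)) ≤ 1 / s + 1 := by
      rw [div_add_one hs0.ne', div_le_div_iff₀ hb hs0]
      linarith
    rw [norm_mul, Real.norm_of_nonneg (Real.exp_nonneg _), Real.norm_eq_abs,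
      show -t * s / 2 = -(t / 2) * s by ring]
    refine mul_le_of_le_one_left (Real.exp_nonneg _) (abs_le.2 ⟨?_, ?_⟩) <;> linarith
  rw [betaFn, ← integral_add h1 h2]
  refine setIntegral_congr_fun measurableSet_Ioi fun s hs ↦ ?_
  have hs0 : 0 < s := hs
  have hq : 0 < 1 - Real.exp (-s) := sub_pos.2 (Real.exp_lt_one_iff.2 (neg_lt_zero.2 hs0))
  have hsh : Real.sinh s = (1 - Real.exp (-s)) * (1 + Real.exp (-s)) / (2 * Real.exp (-s)) := by
    have : Real.exp s * Real.exp (-s) = 1 := by rw [← Real.exp_add]; simp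
    rw [Real.sinh_eq, div_eq_div_iff two_ne_zero (by positivity)]
    linear_combination 2 * this
  rw [hsh, show -t * s / 2 = -(t / 2) * s by ring]
  generalize Real.exp (-s) = q at *
  have hq' : 1 + q ≠ 0 := by
    rintro h
    have := (Real.sinh_pos_iff.2 hs0)
    simp [hsh, h] at this
  field_simp
  ring

lemma integrable_density_div {t : ℝ} (ht : 0 < t) :
    Integrable fun x : ℝ ↦ |x| / ((t ^ 2 + x ^ 2) * (Real.exp (Real.pi * |x| / 2) + 1)) := by
  have ht2 : 0 < min (t ^ 2) 1 := by positivity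
  refine (integrable_inv_one_add_sq.const_mul (1 / min (t ^ 2) 1)).mono'
    (Measurable.aestronglyMeasurable (by fun_prop)) (.of_forall fun x ↦ ?_)
  rw [Real.norm_of_nonneg (by positivity)]
  have h1 : |x| ≤ Real.exp (Real.pi * |x| / 2) + 1 := by
    have := Real.add_one_le_exp (Real.pi * |x| / 2)
    nlinarith [Real.two_le_pi, abs_nonneg x]
  have h2 : min (t ^ 2) 1 * (1 + x ^ 2) ≤ t ^ 2 + x ^ 2 := by
    nlinarith [min_le_left (t ^ 2) 1, min_le_right (t ^ 2) 1, sq_nonneg x]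
  calc |x| / ((t ^ 2 + x ^ 2) * (Real.exp (Real.pi * |x| / 2) + 1))
    _ ≤ (Real.exp (Real.pi * |x| / 2) + 1) /
        ((t ^ 2 + x ^ 2) * (Real.exp (Real.pi * |x| / 2) + 1)) := by gcongr
    _ = 1 / (t ^ 2 + x ^ 2) := by field_simp
    _ ≤ 1 / (min (t ^ 2) 1 * (1 + x ^ 2)) := one_div_le_one_div_of_le (by positivity) h2
    _ = _ := by field_simp

lemma integrable_id_mul_density_div {t : ℝ} (ht : 0 < t) :
    Integrable fun x : ℝ ↦ x * |x| /
      ((t ^ 2 + x ^ 2) * (1 + x ^ 2) * (Real.exp (Real.pi * |x| / 2) + 1)) := by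
  refine integrable_inv_one_add_sq.mono' (Measurable.aestronglyMeasurable (by fun_prop))
    (.of_forall fun x ↦ ?_)
  rw [norm_div, norm_mul, Real.norm_eq_abs, Real.norm_eq_abs, abs_abs,
    Real.norm_of_nonneg (by positivity), abs_mul_abs_self, ← one_div,
    div_le_div_iff₀ (by positivity) (by positivity), one_mul]
  have := Real.exp_pos (Real.pi * |x| / 2)
  calc x * x * (1 + x ^ 2) = (x ^ 2 * (1 + x ^ 2)) * 1 := by ring
    _ ≤ _ := by
      gcongr
      · nlinarith [sq_nonneg t]
      · linarith

lemma integral_eq_zero_of_odd {f : ℝ → ℝ} (hf : ∀ x, f (-x) = -f x) : ∫ x, f x = 0 := by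
  have h := integral_neg_eq_self f volume
  simp only [hf, integral_neg] at h
  linarith

/-- Splitting of the integrand of the free Lévy-Khintchine representation into its
even and odd parts. -/
lemma nevanlinna_kernel_mul_density {t : ℝ} (ht : 0 < t) (x : ℝ) :
    (1 + Complex.I * t * x) / (Complex.I * t - x) *
        (((1 / 2) * |x| * Real.exp (-Real.pi * |x| / 4) /
            ((1 + x ^ 2) * Real.cosh (Real.pi * |x| / 4)) : ℝ) : ℂ) =
      -Complex.I * t *
        ((|x| / ((t ^ 2 + x ^ 2) * (Real.exp (Real.pi * |x| / 2) + 1)) : ℝ) : ℂ) +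
      (t ^ 2 - 1) * ((x * |x| /
        ((t ^ 2 + x ^ 2) * (1 + x ^ 2) * (Real.exp (Real.pi * |x| / 2) + 1)) : ℝ) : ℂ) := by
  have hw : (1 / 2) * |x| * Real.exp (-Real.pi * |x| / 4) /
      ((1 + x ^ 2) * Real.cosh (Real.pi * |x| / 4)) =
        |x| / ((1 + x ^ 2) * (Real.exp (Real.pi * |x| / 2) + 1)) := by
    have h1 : Real.exp (-Real.pi * |x| / 4) = (Real.exp (Real.pi * |x| / 4))⁻¹ := by
      rw [← Real.exp_neg]; ring_nf
    have h2 : Real.exp (Real.pi * |x| / 2) = Real.exp (Real.pi * |x| / 4) ^ 2 := by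
      rw [← Real.exp_nat_mul]; ring_nf
    rw [Real.cosh_eq, Real.exp_neg, h1, h2]
    have := Real.exp_pos (Real.pi * |x| / 4)
    field_simp
  have hden : (Complex.I * t - x) ≠ 0 := fun h ↦ by
    have := congrArg Complex.im h
    simp at this
    exact ht.ne' this
  have h1 : (t : ℂ) ^ 2 + x ^ 2 ≠ 0 := by exact_mod_cast (by positivity : t ^ 2 + x ^ 2 ≠ 0)
  have h2 : (1 : ℂ) + x ^ 2 ≠ 0 := by exact_mod_cast (by positivity : 1 + x ^ 2 ≠ 0)
  have h3 : ((Real.exp (Real.pi * |x| / 2) : ℝ) : ℂ) + 1 ≠ 0 := by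
    exact_mod_cast (by positivity : Real.exp (Real.pi * |x| / 2) + 1 ≠ 0)
  have hk : (1 + Complex.I * t * x) / (Complex.I * t - x) =
      (-Complex.I * t * (1 + x ^ 2) + (t ^ 2 - 1) * x) / (t ^ 2 + x ^ 2) := by
    rw [div_eq_div_iff hden h1]
    linear_combination (t ^ 2 + t ^ 2 * x ^ 2 : ℂ) * Complex.I_sq
  rw [hw, hk]
  push_cast only [Complex.ofReal_div, Complex.ofReal_mul, Complex.ofReal_add, Complex.ofReal_pow,
    Complex.ofReal_one]
  generalize ((Real.exp (Real.pi * |x| / 2) : ℝ) : ℂ) = E at *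
  field_simp

/-- For every `t > 0`,
`-it(β(t/2) + ∫_0^∞ (1/s - 1/(1-e^{-s})) e^{-ts/2} ds)
  = ∫_ℝ (1 + itx)/(it - x) · (1/2)|x| e^{-π|x|/4}/((1+x²) cosh(π|x|/4)) dx`. -/
theorem voiculescu_tanh_representation (t : ℝ) (ht : 0 < t) :
    -Complex.I * (t : ℂ) * ((betaFn (t / 2) : ℂ) +
        ((∫ s in Set.Ioi (0 : ℝ), (1 / s - 1 / (1 - Real.exp (-s))) * Real.exp (-t * s / 2) : ℝ) : ℂ)) =
      ∫ x : ℝ, (1 + Complex.I * t * x) / (Complex.I * t - x) *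
        (((1 / 2) * |x| * Real.exp (-Real.pi * |x| / 4) /
            ((1 + x ^ 2) * Real.cosh (Real.pi * |x| / 4)) : ℝ) : ℂ) := by
  rw [← Complex.ofReal_add, betaFn_add_integral ht, integral_exp_mul_inv_sub_inv_sinh ht]
  simp only [nevanlinna_kernel_mul_density ht]
  rw [integral_add ((integrable_density_div ht).ofReal.const_mul _)
    ((integrable_id_mul_density_div ht).ofReal.const_mul _), integral_const_mul,
    integral_const_mul, integral_complex_ofReal, integral_complex_ofReal,
    integral_eq_zero_of_odd (f := fun x ↦ x * |x| / _) (fun x ↦ by simp [neg_div])]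
  have h := integral_comp_abs
    (f := fun x ↦ x / ((t ^ 2 + x ^ 2) * (Real.exp (Real.pi * x / 2) + 1)))
  simp only [sq_abs] at h
  rw [h, ← integral_const_mul]
  simp only [mul_div_assoc, Complex.ofReal_zero, mul_zero, add_zero]
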